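/- Let L = {B n : n ∈ ℤ³} be a Bravais lattice in ℝ³ with B an invertible real 3×3 matrix and unit-cell volume Ω₀ = |det B|, and let φ₀ : ℝ³ → ℝ be a continuously differentiable kernel (compactly supported, φ₀(−x) = φ₀(x)) satisfying the gradient moment condition −Σ_{y∈L} ∇φ₀(y) yᵀ = (1/Ω₀) I₃ and, in addition, the third-order gradient moment conditions Σ_{y∈L} ∂_{x_α}φ₀(y) y^β y^γ y^δ = 0 for all α, β, γ, δ ∈ {1,2,3}. For ε > 0 and w : ℝ³ → ℝ define the sampled gradient D̃_ε w(x) = −Ω₀ ε^{−1} Σ_{y∈L} ∇φ₀(y) w(x + εy) ∈ ℝ³. Then there exists a constant C, depending only on φ₀ and B, such that for every four times continuously differentiable w : ℝ³ → ℝ whose fourth-order partial derivatives are all bounded in absolute value by M, every ε ∈ (0,1], and every x ∈ ℝ³, one has ‖D̃_ε w(x) − ∇w(x)‖ ≤ C M ε³. -/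

import Mathlib

open scoped BigOperators

/-- The Bravais lattice generated by an (invertible) matrix `B`. -/
def bravaisLattice (B : Matrix (Fin 3) (Fin 3) ℝ) : Set (Fin 3 → ℝ) :=
  {x | ∃ n : Fin 3 → ℤ, x = B.mulVec (fun k => (n k : ℝ))}

theorem neg_mem_bravaisLattice {B : Matrix (Fin 3) (Fin 3) ℝ} {y : Fin 3 → ℝ}
    (hy : y ∈ bravaisLattice B) : -y ∈ bravaisLattice B := by
  obtain ⟨n, rfl⟩ := hy
  refine ⟨-n, ?_⟩
  rw [← Matrix.mulVec_neg]
  congr 1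
  ext k
  simp

theorem finite_bravaisLattice_inter_closedBall {B : Matrix (Fin 3) (Fin 3) ℝ}
    (hB : IsUnit B.det) (R : ℝ) :
    (bravaisLattice B ∩ Metric.closedBall 0 R).Finite := by
  have hcont : Continuous fun y : Fin 3 → ℝ => B⁻¹.mulVec y :=
    Continuous.matrix_mulVec continuous_const continuous_id
  obtain ⟨C, hC⟩ := ((isCompact_closedBall (0 : Fin 3 → ℝ) R).image hcont).isBounded.exists_norm_le
  refine ((Set.finite_Icc (fun _ : Fin 3 => -⌊C⌋) (fun _ => ⌊C⌋)).image
    fun n => B.mulVec fun k => (n k : ℝ)).subset ?_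
  rintro _ ⟨⟨n, rfl⟩, hn⟩
  refine ⟨n, ?_, rfl⟩
  have h := hC _ ⟨_, hn, rfl⟩
  simp only [Matrix.mulVec_mulVec, Matrix.nonsing_inv_mul B hB, Matrix.one_mulVec] at h
  have hk (k : Fin 3) : |(n k : ℝ)| ≤ C := (norm_le_pi_norm (fun k => (n k : ℝ)) k).trans h
  refine ⟨fun k => ?_, fun k => Int.le_floor.2 (abs_le.1 (hk k)).2⟩
  have : -n k ≤ ⌊C⌋ := Int.le_floor.2 (by push_cast; linarith [(abs_le.1 (hk k)).1])
  simp only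
  omega

theorem fderiv_neg_eq_neg_of_even {E F : Type*} [NormedAddCommGroup E] [NormedSpace ℝ E]
    [NormedAddCommGroup F] [NormedSpace ℝ F] {f : E → F} (hf : ∀ x, f (-x) = f x) (x : E) :
    fderiv ℝ f (-x) = -fderiv ℝ f x := by
  have h := (ContinuousLinearEquiv.neg ℝ (M := E)).comp_right_fderiv (f := f) (x := x)
  have hcomp : f ∘ ContinuousLinearEquiv.neg ℝ (M := E) = f := funext hf
  rw [hcomp] at h
  ext v
  simp [h]

theorem Finset.sum_eq_zero_of_odd {E : Type*} [InvolutiveNeg E] {s : Finset E}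
    (hs : ∀ y ∈ s, -y ∈ s) {f : E → ℝ} (hf : ∀ y, f (-y) = -f y) : ∑ y ∈ s, f y = 0 := by
  have h : ∑ y ∈ s, f y = ∑ y ∈ s, f (-y) :=
    Finset.sum_nbij' (fun y => -y) (fun y => -y) hs hs (by simp) (by simp) (by simp)
  simp only [hf, Finset.sum_neg_distrib] at h
  linarith

theorem ContinuousMultilinearMap.apply_const_eq_sum {ι : Type*} [Fintype ι] [DecidableEq ι]
    {k : ℕ} (f : (ι → ℝ) [×k]→L[ℝ] ℝ) (y : ι → ℝ) :
    f (fun _ => y) =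
      ∑ r : Fin k → ι, (∏ i, y (r i)) * f (fun i => Pi.single (r i) 1) := by
  have hy : y = ∑ j, y j • (Pi.single j 1 : ι → ℝ) := pi_eq_sum_univ' y
  conv_lhs => rw [hy]
  rw [f.map_sum]
  exact Finset.sum_congr rfl fun r _ => f.map_smul_univ _ _

theorem ContinuousMultilinearMap.abs_apply_const_le {ι : Type*} [Fintype ι] [DecidableEq ι]
    {k : ℕ} (f : (ι → ℝ) [×k]→L[ℝ] ℝ) {M : ℝ}
    (hM : ∀ r : Fin k → ι, |f (fun i => Pi.single (r i) 1)| ≤ M) (y : ι → ℝ) :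
    |f (fun _ => y)| ≤ (Fintype.card ι : ℝ) ^ k * (‖y‖ ^ k * M) := by
  rw [f.apply_const_eq_sum]
  refine (Finset.abs_sum_le_sum_abs _ _).trans ?_
  have h : ∀ r ∈ (Finset.univ : Finset (Fin k → ι)),
      |(∏ i, y (r i)) * f (fun i => Pi.single (r i) 1)| ≤ ‖y‖ ^ k * M := by
    intro r _
    rw [abs_mul, Finset.abs_prod]
    refine mul_le_mul ?_ (hM r) (abs_nonneg _) (by positivity)
    simpa using Finset.prod_le_prod (s := Finset.univ) (fun i _ => abs_nonneg (y (r i)))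
      (fun i _ => norm_le_pi_norm y (r i))
  simpa using Finset.sum_le_card_nsmul _ _ _ h

/-- The third order Taylor expansion along `ε • y`, with remainder bounded by the size of the
fourth order partial derivatives. -/
theorem abs_sub_taylor_three_le {ι : Type*} [Fintype ι] [DecidableEq ι] {w : (ι → ℝ) → ℝ}
    (hw : ContDiff ℝ 4 w) {M : ℝ}
    (hM : ∀ (x : ι → ℝ) (r : Fin 4 → ι),
      |iteratedFDeriv ℝ 4 w x (fun k => Pi.single (r k) 1)| ≤ M)
    (x y : ι → ℝ) {ε : ℝ} (hε : 0 ≤ ε) :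
    |w (x + ε • y) - (w x + ε * fderiv ℝ w x y
        + ε ^ 2 / 2 * iteratedFDeriv ℝ 2 w x (fun _ => y)
        + ε ^ 3 / 6 * iteratedFDeriv ℝ 3 w x (fun _ => y))|
      ≤ (Fintype.card ι : ℝ) ^ 4 / 6 * ‖y‖ ^ 4 * M * ε ^ 4 := by
  have hT := map_add_eq_sum_add_integral_iteratedFDeriv (f := w) (x := x) (y := ε • y) (n := 3)
    fun t _ => by exact_mod_cast hw.contDiffAt
  have hs (k : ℕ) : iteratedFDeriv ℝ k w x (fun _ => ε • y)
      = ε ^ k * iteratedFDeriv ℝ k w x (fun _ => y) := by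
    simpa using (iteratedFDeriv ℝ k w x).map_smul_univ (fun _ => ε) (fun _ => y)
  have hR : ‖∫ t in (0 : ℝ)..1,
      (1 - t) ^ 3 • iteratedFDeriv ℝ (3 + 1) w (x + t • ε • y) (fun _ => ε • y)‖
      ≤ (Fintype.card ι : ℝ) ^ 4 * (‖ε • y‖ ^ 4 * M) * |(1 : ℝ) - 0| := by
    refine intervalIntegral.norm_integral_le_of_norm_le_const fun t ht => ?_
    rw [Set.uIoc_of_le zero_le_one] at ht
    rw [norm_smul]
    have h1 : ‖(1 - t) ^ 3‖ ≤ 1 := by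
      rw [norm_pow]
      refine pow_le_one₀ (norm_nonneg _) ?_
      rw [Real.norm_eq_abs, abs_le]
      constructor <;> linarith [ht.1, ht.2]
    have h2 := (iteratedFDeriv ℝ 4 w (x + t • ε • y)).abs_apply_const_le (hM _) (ε • y)
    exact (mul_le_of_le_one_left (norm_nonneg _) h1).trans h2
  rw [norm_smul, Real.norm_of_nonneg hε, Real.norm_eq_abs] at hR
  simp only [Finset.sum_range_succ, Finset.sum_range_zero, hs, smul_eq_mul] at hT
  rw [hT]
  simp only [smul_eq_mul] at hR
  set I := ∫ t in (0 : ℝ)..1,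
      (1 - t) ^ 3 * iteratedFDeriv ℝ (3 + 1) w (x + t • ε • y) (fun _ => ε • y)
  have hI := abs_le.1 hR
  simp only [sub_zero, abs_one, mul_one, Nat.factorial, iteratedFDeriv_zero_apply,
    iteratedFDeriv_one_apply] at hI ⊢
  rw [abs_le]
  push_cast
  constructor <;> ring_nf at hI ⊢ <;> linarith [hI.1, hI.2]

/-- An odd weight with vanishing third moments reproduces directional derivatives of `C⁴` functions
from finitely many samples, up to a fourth order error. -/
theorem abs_sum_mul_sub_fderiv_le {ι : Type*} [Fintype ι] [DecidableEq ι] {s : Finset (ι → ℝ)}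
    (hs : ∀ y ∈ s, -y ∈ s) {g : (ι → ℝ) → ℝ} (hg : ∀ y, g (-y) = -g y)
    {m : ι → ℝ} (h1 : ∀ β, ∑ y ∈ s, g y * y β = m β)
    (h3 : ∀ β γ δ, ∑ y ∈ s, g y * y β * y γ * y δ = 0)
    {w : (ι → ℝ) → ℝ} (hw : ContDiff ℝ 4 w) {M : ℝ}
    (hM : ∀ (x : ι → ℝ) (r : Fin 4 → ι),
      |iteratedFDeriv ℝ 4 w x (fun k => Pi.single (r k) 1)| ≤ M)
    (x : ι → ℝ) {ε : ℝ} (hε : 0 ≤ ε) :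
    |∑ y ∈ s, g y * w (x + ε • y) - ε * fderiv ℝ w x m|
      ≤ (∑ y ∈ s, |g y| * ((Fintype.card ι : ℝ) ^ 4 / 6 * ‖y‖ ^ 4)) * M * ε ^ 4 := by
  have e0 : ∑ y ∈ s, g y = 0 := Finset.sum_eq_zero_of_odd hs hg
  have e1 : ∑ y ∈ s, g y * fderiv ℝ w x y = fderiv ℝ w x m := by
    have hm : ∑ y ∈ s, g y • y = m := by
      ext β
      simpa using h1 β
    rw [← hm, map_sum]
    simp
  have e2 : ∑ y ∈ s, g y * iteratedFDeriv ℝ 2 w x (fun _ => y) = 0 := by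
    refine Finset.sum_eq_zero_of_odd hs fun y => ?_
    have h := (iteratedFDeriv ℝ 2 w x).map_smul_univ (fun _ => (-1 : ℝ)) (fun _ => y)
    simp only [neg_smul, one_smul, Finset.prod_const, Finset.card_univ, Fintype.card_fin,
      even_two, Even.neg_pow, one_pow] at h
    rw [hg, h, neg_mul]
  have e3 : ∑ y ∈ s, g y * iteratedFDeriv ℝ 3 w x (fun _ => y) = 0 := by
    simp_rw [ContinuousMultilinearMap.apply_const_eq_sum, Finset.mul_sum]
    rw [Finset.sum_comm]
    refine Finset.sum_eq_zero fun r _ => ?_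
    simp_rw [← mul_assoc, ← Finset.sum_mul, Fin.prod_univ_three, ← mul_assoc]
    rw [h3, zero_mul]
  have key : ∑ y ∈ s, g y * w (x + ε • y) - ε * fderiv ℝ w x m
      = ∑ y ∈ s, g y * (w (x + ε • y) - (w x + ε * fderiv ℝ w x y
        + ε ^ 2 / 2 * iteratedFDeriv ℝ 2 w x (fun _ => y)
        + ε ^ 3 / 6 * iteratedFDeriv ℝ 3 w x (fun _ => y))) := by
    simp only [mul_sub, mul_add, Finset.sum_sub_distrib, Finset.sum_add_distrib,
      mul_left_comm (g _), ← Finset.mul_sum, e1, e2, e3]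
    rw [← Finset.sum_mul, e0]
    ring
  rw [key, Finset.sum_mul, Finset.sum_mul]
  refine (Finset.abs_sum_le_sum_abs _ _).trans (Finset.sum_le_sum fun y _ => ?_)
  rw [abs_mul, mul_assoc, mul_assoc]
  refine mul_le_mul_of_nonneg_left ?_ (abs_nonneg _)
  exact (abs_sub_taylor_three_le hw hM x y hε).trans_eq (by ring)

/-- Let `L` be a Bravais lattice with unit-cell volume `Ω₀ = |det B|`
and `φ₀` a compactly supported even `C¹` kernel satisfying the gradient moment condition
`−Σ_{y∈L} ∇φ₀(y) yᵀ = (1/Ω₀) I₃` and the third-order gradient moment conditions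
`Σ_{y∈L} ∂_α φ₀(y) yᵝ yᵞ yᵟ = 0`. Then there is a constant `C` (depending only on `φ₀`
and `B`) such that for every `C⁴` function `w` with fourth partial derivatives bounded by
`M`, every `ε ∈ (0,1]`, and every `x`, the sampled gradient
`D̃_ε w(x) = −Ω₀ ε⁻¹ Σ_{y∈L} ∇φ₀(y) w(x + εy)` satisfies
`‖D̃_ε w(x) − ∇w(x)‖ ≤ C M ε³`. -/
theorem sampled_gradient_third_order_accuracy
    (B : Matrix (Fin 3) (Fin 3) ℝ) (hB : IsUnit B.det)
    (φ₀ : (Fin 3 → ℝ) → ℝ) (hφ : ContDiff ℝ 1 φ₀) (hc : HasCompactSupport φ₀)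
    (hsymm : ∀ x : Fin 3 → ℝ, φ₀ (-x) = φ₀ x)
    (hμ1 : ∀ α β : Fin 3,
      (- ∑ᶠ y ∈ bravaisLattice B, fderiv ℝ φ₀ y (Pi.single α 1) * y β)
        = (1 / |B.det|) * (if α = β then 1 else 0))
    (hμ3 : ∀ α β γ δ : Fin 3,
      (∑ᶠ y ∈ bravaisLattice B,
        fderiv ℝ φ₀ y (Pi.single α 1) * y β * y γ * y δ) = 0) :
    ∃ C : ℝ, ∀ (w : (Fin 3 → ℝ) → ℝ) (M : ℝ), ContDiff ℝ 4 w →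
      (∀ (x : Fin 3 → ℝ) (idx : Fin 4 → Fin 3),
        |iteratedFDeriv ℝ 4 w x (fun k => Pi.single (idx k) 1)| ≤ M) →
      ∀ ε : ℝ, ε ∈ Set.Ioc (0:ℝ) 1 → ∀ x : Fin 3 → ℝ,
        ‖(fun α : Fin 3 => -(|B.det| * ε⁻¹) *
              (∑ᶠ y ∈ bravaisLattice B,
                fderiv ℝ φ₀ y (Pi.single α 1) * w (x + ε • y)))
          - (fun α : Fin 3 => fderiv ℝ w x (Pi.single α 1))‖
          ≤ C * M * ε ^ 3 := by
  obtain ⟨R, hR⟩ := hc.isCompact.isBounded.subset_closedBall 0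
  have hfin := finite_bravaisLattice_inter_closedBall hB R
  set s := hfin.toFinset with hs_def
  have hmem (y : Fin 3 → ℝ) : y ∈ s ↔ y ∈ bravaisLattice B ∧ y ∈ Metric.closedBall 0 R := by
    simp [hs_def]
  have hs : ∀ y ∈ s, -y ∈ s := fun y hy => by
    rw [hmem] at hy ⊢
    exact ⟨neg_mem_bravaisLattice hy.1, by simpa using hy.2⟩
  have hsum (f : (Fin 3 → ℝ) → ℝ) (hf : ∀ y, fderiv ℝ φ₀ y = 0 → f y = 0) :
      ∑ᶠ y ∈ bravaisLattice B, f y = ∑ y ∈ s, f y := by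
    refine finsum_mem_eq_sum_of_subset _ ?_ fun y hy => ((hmem y).1 hy).1
    rintro y ⟨hy, hfy⟩
    refine (hmem y).2 ⟨hy, ?_⟩
    by_contra hyR
    exact hfy (hf y (image_eq_zero_of_notMem_tsupport
      fun h => hyR (hR (tsupport_fderiv_subset ℝ h))))
  set g : Fin 3 → (Fin 3 → ℝ) → ℝ := fun α y => fderiv ℝ φ₀ y (Pi.single α 1) with hg_def
  have hg (α : Fin 3) (y : Fin 3 → ℝ) : g α (-y) = -g α y := by
    simp [hg_def, fderiv_neg_eq_neg_of_even hsymm]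
  have hdet : 0 < |B.det| := abs_pos.2 hB.ne_zero
  have h1 (α β : Fin 3) :
      ∑ y ∈ s, g α y * y β = (-(1 / |B.det|) • (Pi.single α 1 : Fin 3 → ℝ)) β := by
    have h := hμ1 α β
    rw [hsum _ fun y hy => by simp [hy]] at h
    rw [neg_eq_iff_eq_neg] at h
    rw [h, Pi.smul_apply, Pi.single_apply, smul_eq_mul, neg_mul]
    simp only [eq_comm]
  have h3 (α β γ δ : Fin 3) : ∑ y ∈ s, g α y * y β * y γ * y δ = 0 := by
    have h := hμ3 α β γ δ
    rwa [hsum _ fun y hy => by simp [hy]] at h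
  set A : Fin 3 → ℝ := fun α =>
    ∑ y ∈ s, |g α y| * ((Fintype.card (Fin 3) : ℝ) ^ 4 / 6 * ‖y‖ ^ 4) with hA_def
  have hA (α : Fin 3) : 0 ≤ A α := Finset.sum_nonneg fun y _ => by positivity
  refine ⟨|B.det| * ∑ α, A α, fun w M hw hM ε hε x => ?_⟩
  have hM0 : 0 ≤ M := (abs_nonneg _).trans (hM 0 0)
  have hε0 : 0 < ε := hε.1
  have hAsum : 0 ≤ ∑ α, A α := Finset.sum_nonneg fun α _ => hA α
  refine (pi_norm_le_iff_of_nonneg (by positivity)).2 fun α => ?_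
  have hmain := abs_sum_mul_sub_fderiv_le hs (hg α) (h1 α) (h3 α) hw hM x hε0.le
  rw [map_smul, smul_eq_mul] at hmain
  rw [Pi.sub_apply, hsum _ fun y hy => by simp [hy], Real.norm_eq_abs]
  have hrw : -(|B.det| * ε⁻¹) * ∑ y ∈ s, fderiv ℝ φ₀ y (Pi.single α 1) * w (x + ε • y)
        - fderiv ℝ w x (Pi.single α 1)
      = -(|B.det| * ε⁻¹) * (∑ y ∈ s, g α y * w (x + ε • y)
        - ε * (-(1 / |B.det|) * fderiv ℝ w x (Pi.single α 1))) := by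
    simp only [hg_def]
    field_simp
    ring
  rw [hrw, abs_mul, abs_neg, abs_of_pos (by positivity : 0 < |B.det| * ε⁻¹)]
  calc |B.det| * ε⁻¹ * _ ≤ |B.det| * ε⁻¹ * (A α * M * ε ^ 4) := by gcongr
    _ = |B.det| * A α * M * ε ^ 3 := by field_simp
    _ ≤ |B.det| * (∑ α, A α) * M * ε ^ 3 := by
      gcongr
      exact Finset.single_le_sum (fun α _ => hA α) (Finset.mem_univ α)
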